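/- Let G be a cubic graph (a 3-regular graph, possibly with multiple edges but no loops) that has three pairwise edge-disjoint perfect matchings M1, M2 and M3 such that both the edge sets M1 ∪ M2 and M1 ∪ M3 induce Hamiltonian circuits of G. Let F be a non-empty subset of M2 and let α be an edge in M3. Then G has two perfect matchings M4 and M5 such that: (1) either M4 ∩ M5 ⊆ M3 ⊆ M4 ∪ M5 or M4 ∩ M5 ⊆ M1 ⊆ M4 ∪ M5; (2) the subgraph of G induced by the edge set M4 ∪ M5 has a circuit C containing α such that F ∩ E(C) ≠ ∅ and every circuit of that subgraph different from C contains no edge of F; and (3) if M1 ⊆ M4 ∪ M5, then G has a circuit C′ containing α such that M2 ∩ E(C) ∩ E(C′) = ∅, M3 \ (M4 ∪ M5) ⊆ M3 \ E(C′), and M3 \ E(C′) is a perfect matching of G − V(C′). -/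

import Mathlib

/-- A multigraph on vertex type `V` with edge type `E`: each edge is assigned an
unordered pair of distinct endpoints (multiple edges allowed, loops forbidden). -/
structure Multigraph (V : Type*) (E : Type*) where
  inc : E → Sym2 V
  no_loops : ∀ e : E, ¬ (inc e).IsDiag

namespace Multigraph

variable {V E : Type*} (G : Multigraph V E)

/-- The set of vertices incident with some edge in the edge set `F`. -/
def supp (F : Set E) : Set V := {v | ∃ e ∈ F, v ∈ G.inc e}

/-- The degree of a vertex `v` in the subgraph given by the edge set `F`. -/
noncomputable def deg (F : Set E) (v : V) : ℕ := {e ∈ F | v ∈ G.inc e}.ncard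

/-- `G` is cubic, i.e. 3-regular. -/
def IsCubic : Prop := ∀ v : V, G.deg Set.univ v = 3

/-- Adjacency via an edge of the edge set `F`. -/
def Adj (F : Set E) (u v : V) : Prop := ∃ e ∈ F, G.inc e = s(u, v)

/-- `u` and `v` are joined by a walk using only edges of `F`. -/
def Reach (F : Set E) : V → V → Prop := Relation.ReflTransGen (G.Adj F)

/-- `G` is bridgeless: no edge is a cut edge, i.e. the ends of every edge are
joined by a walk avoiding that edge. -/
def Bridgeless : Prop :=
  ∀ e : E, ∀ u v : V, G.inc e = s(u, v) → G.Reach (Set.univ \ {e}) u v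

/-- `M` is a perfect matching of the subgraph of `G` with vertex set `S` whose
edges are the edges of `F` having both ends in `S`: the edges of `M` lie in `F`,
have both ends in `S`, and every vertex of `S` lies on exactly one edge of `M`. -/
def IsPMOn (S : Set V) (F : Set E) (M : Set E) : Prop :=
  M ⊆ F ∧ (∀ e ∈ M, ∀ v ∈ G.inc e, v ∈ S) ∧ ∀ v ∈ S, ∃! e, e ∈ M ∧ v ∈ G.inc e

/-- `M` is a perfect matching of `G`. -/
def IsPM (M : Set E) : Prop := G.IsPMOn Set.univ Set.univ M

/-- The edge set `C` is a circuit of `G`: nonempty, 2-regular, and connected. -/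
def IsCircuit (C : Set E) : Prop :=
  C.Nonempty ∧ (∀ v ∈ G.supp C, G.deg C v = 2) ∧
    ∀ u ∈ G.supp C, ∀ v ∈ G.supp C, G.Reach C u v

end Multigraph
namespace Multigraph

section AlternatingSets

variable {V E : Type*} {G : Multigraph V E} {M N C D : Set E}

/-- `C` is a union of connected components of the graph with edge set `M ∪ N`. -/
def IsUnionOfComponents (G : Multigraph V E) (M N C : Set E) : Prop :=
  C ⊆ M ∪ N ∧ ∀ v ∈ G.supp C, ∀ e ∈ M ∪ N, v ∈ G.inc e → e ∈ C

/-- Exchange `M` for `N` along the edge set `C`. -/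
def exchange (M N C : Set E) : Set E := M \ C ∪ N ∩ C

theorem IsUnionOfComponents.symm (h : G.IsUnionOfComponents M N C) :
    G.IsUnionOfComponents N M C := by
  unfold IsUnionOfComponents at *
  rwa [Set.union_comm]

theorem IsPM.eq_of_mem (hM : G.IsPM M) {v : V} {e f : E} (he : e ∈ M) (hf : f ∈ M)
    (hve : v ∈ G.inc e) (hvf : v ∈ G.inc f) : e = f :=
  (hM.2.2 v (Set.mem_univ v)).unique ⟨he, hve⟩ ⟨hf, hvf⟩

theorem IsPM.exists_mem (hM : G.IsPM M) (v : V) : ∃ e ∈ M, v ∈ G.inc e :=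
  (hM.2.2 v (Set.mem_univ v)).exists

theorem isPM_exchange (hM : G.IsPM M) (hN : G.IsPM N)
    (hC : G.IsUnionOfComponents M N C) : G.IsPM (exchange M N C) := by
  refine ⟨Set.subset_univ _, fun _ _ _ _ => Set.mem_univ _, fun v _ => ?_⟩
  by_cases hv : v ∈ G.supp C
  · obtain ⟨n, hn, hvn⟩ := hN.exists_mem v
    refine ⟨n, ⟨Or.inr ⟨hn, hC.2 v hv n (Or.inr hn) hvn⟩, hvn⟩, ?_⟩
    rintro e ⟨⟨heM, heC⟩ | ⟨heN, -⟩, hve⟩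
    · exact absurd (hC.2 v hv e (Or.inl heM) hve) heC
    · exact hN.eq_of_mem heN hn hve hvn
  · obtain ⟨m, hm, hvm⟩ := hM.exists_mem v
    refine ⟨m, ⟨Or.inl ⟨hm, fun h => hv ⟨m, h, hvm⟩⟩, hvm⟩, ?_⟩
    rintro e ⟨⟨heM, -⟩ | ⟨-, heC⟩, hve⟩
    · exact hM.eq_of_mem heM hm hve hvm
    · exact absurd ⟨e, heC, hve⟩ hv

theorem IsCircuit.isUnionOfComponents [Finite E] (hM : G.IsPM M) (hN : G.IsPM N)
    (hC : G.IsCircuit C) (hCMN : C ⊆ M ∪ N) : G.IsUnionOfComponents M N C := by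
  refine ⟨hCMN, fun v hv e he hve => ?_⟩
  obtain ⟨m, hm, hvm⟩ := hM.exists_mem v
  obtain ⟨n, hn, hvn⟩ := hN.exists_mem v
  have key : ∀ f ∈ M ∪ N, v ∈ G.inc f → f ∈ ({m, n} : Set E) := by
    rintro f (hf | hf) hvf
    · exact Or.inl (hM.eq_of_mem hf hm hvf hvm)
    · exact Or.inr (hN.eq_of_mem hf hn hvf hvn)
  have hsub : {f ∈ C | v ∈ G.inc f} ⊆ ({m, n} : Set E) := fun f hf => key f (hCMN hf.1) hf.2
  have heq := Set.eq_of_subset_of_ncard_le hsub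
    (((Set.ncard_insert_le m {n}).trans_eq (by rw [Set.ncard_singleton])).trans (hC.2.1 v hv).ge)
  have : e ∈ {f ∈ C | v ∈ G.inc f} := heq ▸ key e he hve
  exact this.1

theorem IsCircuit.subset_of_isUnionOfComponents (hC : G.IsCircuit C) (hCMN : C ⊆ M ∪ N)
    (hD : G.IsUnionOfComponents M N D) {e : E} (heC : e ∈ C) (heD : e ∈ D) : C ⊆ D := by
  intro f hf
  obtain ⟨u, hu⟩ : ∃ u, u ∈ G.inc e := ⟨_, Sym2.out_fst_mem _⟩
  obtain ⟨w, hw⟩ : ∃ w, w ∈ G.inc f := ⟨_, Sym2.out_fst_mem _⟩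
  have hreach : G.Reach C u w := hC.2.2 u ⟨e, heC, hu⟩ w ⟨f, hf, hw⟩
  suffices w ∈ G.supp D from hD.2 w this f (hCMN hf) hw
  clear hw
  unfold Reach at hreach
  induction hreach with
  | refl => exact ⟨e, heD, hu⟩
  | tail _ hab ih =>
    obtain ⟨g, hg, hinc⟩ := hab
    exact ⟨g, hD.2 _ ih g (hCMN hg) (by simp [hinc]), by simp [hinc]⟩

theorem IsCircuit.eq_of_mem_of_mem [Finite E] (hM : G.IsPM M) (hN : G.IsPM N)
    (hC : G.IsCircuit C) (hD : G.IsCircuit D) (hCMN : C ⊆ M ∪ N) (hDMN : D ⊆ M ∪ N)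
    {e : E} (heC : e ∈ C) (heD : e ∈ D) : C = D :=
  (hC.subset_of_isUnionOfComponents hCMN (hD.isUnionOfComponents hM hN hDMN) heC heD).antisymm
    (hD.subset_of_isUnionOfComponents hDMN (hC.isUnionOfComponents hM hN hCMN) heD heC)

theorem Reach.symm {u v : V} (h : G.Reach D u v) : G.Reach D v u :=
  have : Std.Symm (G.Adj D) := ⟨fun _ _ ⟨e, he, hinc⟩ => ⟨e, he, hinc.trans Sym2.eq_swap⟩⟩
  Relation.ReflTransGen.stdSymm.symm _ _ h

theorem exists_isCircuit_mem (hM : G.IsPM M) (hN : G.IsPM N) {e : E} (heN : e ∈ N)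
    (heM : e ∉ M) : ∃ C, G.IsCircuit C ∧ C ⊆ M ∪ N ∧ e ∈ C := by
  obtain ⟨u, hu⟩ : ∃ u, u ∈ G.inc e := ⟨_, Sym2.out_fst_mem _⟩
  let S : Set E := M \ N ∪ N \ M
  let D : Set E := {f ∈ S | ∃ v ∈ G.inc f, G.Reach S u v}
  have reach_of_mem : ∀ f ∈ D, ∀ v ∈ G.inc f, G.Reach S u v := by
    rintro f ⟨hfS, w, hw, huw⟩ v hv
    by_cases hvw : w = v
    · exact hvw ▸ huw
    · exact huw.tail ⟨f, hfS, (Sym2.mem_and_mem_iff hvw).1 ⟨hw, hv⟩⟩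
  have reach_in : ∀ v, G.Reach S u v → G.Reach D u v := by
    intro v h
    unfold Reach at h
    induction h with
    | refl => exact Relation.ReflTransGen.refl
    | @tail b c hub hbc ih =>
      obtain ⟨f, hf, hinc⟩ := hbc
      exact ih.tail ⟨f, ⟨hf, b, by simp [hinc], hub⟩, hinc⟩
  have heD : e ∈ D := ⟨Or.inr ⟨heN, heM⟩, u, hu, Relation.ReflTransGen.refl⟩
  refine ⟨D, ⟨⟨e, heD⟩, ?_, ?_⟩, ?_, heD⟩
  · rintro v ⟨f, hf, hvf⟩
    have huv := reach_of_mem f hf v hvf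
    obtain ⟨m, hm, hvm⟩ := hM.exists_mem v
    obtain ⟨n, hn, hvn⟩ := hN.exists_mem v
    have hmn : m ≠ n := by
      rintro rfl
      rcases hf.1 with h | h
      · exact h.2 (hM.eq_of_mem h.1 hm hvf hvm ▸ hn)
      · exact h.2 (hN.eq_of_mem h.1 hn hvf hvn ▸ hm)
    have hset : {g ∈ D | v ∈ G.inc g} = {m, n} := by
      ext g
      constructor
      · rintro ⟨⟨hg | hg, -⟩, hvg⟩
        · exact Or.inl (hM.eq_of_mem hg.1 hm hvg hvm)
        · exact Or.inr (hN.eq_of_mem hg.1 hn hvg hvn)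
      · rintro (rfl | rfl)
        · exact ⟨⟨Or.inl ⟨hm, fun h => hmn (hN.eq_of_mem h hn hvm hvn)⟩, v, hvm, huv⟩, hvm⟩
        · exact ⟨⟨Or.inr ⟨hn, fun h => hmn (hM.eq_of_mem hm h hvm hvn)⟩, v, hvn, huv⟩, hvn⟩
    rw [deg, hset, Set.ncard_pair hmn]
  · rintro v ⟨f, hf, hvf⟩ w ⟨g, hg, hwg⟩
    exact (reach_in v (reach_of_mem f hf v hvf)).symm.trans
      (reach_in w (reach_of_mem g hg w hwg))
  · rintro f ⟨hf | hf, -⟩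
    · exact Or.inl hf.1
    · exact Or.inr hf.1

theorem isPMOn_diff (hM : G.IsPM M) (hC : G.IsUnionOfComponents N M C) :
    G.IsPMOn (Set.univ \ G.supp C) Set.univ (M \ C) := by
  refine ⟨Set.subset_univ _, fun e he v hv => ⟨Set.mem_univ v, fun hvC => ?_⟩, ?_⟩
  · exact he.2 (hC.2 v hvC e (Or.inr he.1) hv)
  · rintro v ⟨-, hv⟩
    obtain ⟨m, hm, hvm⟩ := hM.exists_mem v
    exact ⟨m, ⟨⟨hm, fun h => hv ⟨m, h, hvm⟩⟩, hvm⟩,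
      fun e he => hM.eq_of_mem he.1.1 hm he.2 hvm⟩

theorem mem_of_isCubic [Finite E] {M₁ M₂ M₃ : Set E} (hG : G.IsCubic) (h₁ : G.IsPM M₁)
    (h₂ : G.IsPM M₂) (h₃ : G.IsPM M₃) (h₁₂ : Disjoint M₁ M₂) (h₁₃ : Disjoint M₁ M₃)
    (h₂₃ : Disjoint M₂ M₃) (e : E) : e ∈ M₁ ∨ e ∈ M₂ ∨ e ∈ M₃ := by
  obtain ⟨v, hv⟩ : ∃ v, v ∈ G.inc e := ⟨_, Sym2.out_fst_mem _⟩
  obtain ⟨a, ha, hva⟩ := h₁.exists_mem v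
  obtain ⟨b, hb, hvb⟩ := h₂.exists_mem v
  obtain ⟨c, hc, hvc⟩ := h₃.exists_mem v
  have hcard : ({a, b, c} : Set E).ncard = 3 :=
    Set.ncard_eq_three.2 ⟨a, b, c, h₁₂.ne_of_mem ha hb, h₁₃.ne_of_mem ha hc,
      h₂₃.ne_of_mem hb hc, rfl⟩
  have hsub : ({a, b, c} : Set E) ⊆ {f ∈ Set.univ | v ∈ G.inc f} := by
    rintro f (rfl | rfl | rfl) <;> exact ⟨Set.mem_univ _, by assumption⟩
  have heq := Set.eq_of_subset_of_ncard_le hsub ((hG v).trans hcard.symm).le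
  have he : e ∈ ({a, b, c} : Set E) := heq ▸ ⟨Set.mem_univ e, hv⟩
  rcases he with rfl | rfl | rfl
  · exact Or.inl ha
  · exact Or.inr (Or.inl hb)
  · exact Or.inr (Or.inr hc)

end AlternatingSets

end Multigraph

open Multigraph in
/-- Lemma 1 (the technical lemma). -/
theorem statement_0 {V E : Type*} [Fintype V] [Fintype E] (G : Multigraph V E)
    (hcubic : G.IsCubic) (M1 M2 M3 : Set E)
    (hM1 : G.IsPM M1) (hM2 : G.IsPM M2) (hM3 : G.IsPM M3)
    (h12 : M1 ∩ M2 = ∅) (h13 : M1 ∩ M3 = ∅) (h23 : M2 ∩ M3 = ∅)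
    (hH12 : G.IsCircuit (M1 ∪ M2) ∧ G.supp (M1 ∪ M2) = Set.univ)
    (hH13 : G.IsCircuit (M1 ∪ M3) ∧ G.supp (M1 ∪ M3) = Set.univ)
    (F : Set E) (hFsub : F ⊆ M2) (hFne : F.Nonempty)
    (α : E) (hα : α ∈ M3) :
    ∃ M4 M5 : Set E, G.IsPM M4 ∧ G.IsPM M5 ∧
      ((M4 ∩ M5 ⊆ M3 ∧ M3 ⊆ M4 ∪ M5) ∨ (M4 ∩ M5 ⊆ M1 ∧ M1 ⊆ M4 ∪ M5)) ∧
      ∃ C : Set E, G.IsCircuit C ∧ C ⊆ M4 ∪ M5 ∧ α ∈ C ∧ (F ∩ C).Nonempty ∧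
        (∀ C'' : Set E, G.IsCircuit C'' → C'' ⊆ M4 ∪ M5 → C'' ≠ C → F ∩ C'' = ∅) ∧
        (M1 ⊆ M4 ∪ M5 →
          ∃ C' : Set E, G.IsCircuit C' ∧ α ∈ C' ∧ M2 ∩ C ∩ C' = ∅ ∧
            M3 \ (M4 ∪ M5) ⊆ M3 \ C' ∧
            G.IsPMOn (Set.univ \ G.supp C') Set.univ (M3 \ C')) := by
  have h12' : Disjoint M1 M2 := Set.disjoint_iff_inter_eq_empty.2 h12
  have h13' : Disjoint M1 M3 := Set.disjoint_iff_inter_eq_empty.2 h13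
  have h23' : Disjoint M2 M3 := Set.disjoint_iff_inter_eq_empty.2 h23
  have hα1 : α ∉ M1 := fun h => h13'.ne_of_mem h hα rfl
  -- Among the perfect matchings avoiding `α` and meeting `F`, take `P` with the fewest `M2`-edges.
  obtain ⟨P, ⟨hP, hαP, hPF⟩, hmin⟩ := Set.exists_min_image
    {P : Set E | G.IsPM P ∧ α ∉ P ∧ (F ∩ P).Nonempty} (fun P => (P ∩ M2).ncard)
    (Set.toFinite _) ⟨M2, hM2, fun h => h23'.ne_of_mem h hα rfl,
      hFne.mono fun e he => ⟨he, hFsub he⟩⟩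
  obtain ⟨C', hC', hC'sub, hαC'⟩ := exists_isCircuit_mem hP hM3 hα hαP
  have hK' := hC'.isUnionOfComponents hP hM3 hC'sub
  by_cases hFC' : (F ∩ C').Nonempty
  · refine ⟨M3, exchange M3 P C', hM3, isPM_exchange hM3 hP hK'.symm,
      Or.inl ⟨Set.inter_subset_left, Set.subset_union_left⟩, C', hC', ?_, hαC', hFC', ?_, ?_⟩
    · intro e he
      rcases hC'sub he with h | h
      · exact Or.inr (Or.inr ⟨h, he⟩)
      · exact Or.inl h
    · intro C'' hC'' hsub hne
      by_contra hcon
      obtain ⟨e, heF, heC''⟩ := Set.nonempty_iff_ne_empty.2 hcon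
      have heM3 : e ∉ M3 := fun h => h23'.ne_of_mem (hFsub heF) h rfl
      have heC' : e ∈ C' := by
        rcases hsub heC'' with h | h | h
        · exact absurd h heM3
        · exact absurd h.1 heM3
        · exact h.2
      refine hne (hC''.eq_of_mem_of_mem hP hM3 hC' (fun g hg => ?_) hC'sub heC'' heC')
      rcases hsub hg with h | h | h
      · exact Or.inr h
      · exact Or.inr h.1
      · exact Or.inl h.1
    · intro hM1sub
      obtain ⟨f, hfF, hfC'⟩ := hFC'
      obtain ⟨u, hu⟩ : ∃ u, u ∈ G.inc f := ⟨_, Sym2.out_fst_mem _⟩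
      obtain ⟨m, hm, hum⟩ := hM1.exists_mem u
      have hfP : f ∈ P := (hC'sub hfC').resolve_right
        fun h => h23'.ne_of_mem (hFsub hfF) h rfl
      have hmP : m ∈ P := by
        rcases hM1sub hm with h | h | h
        · exact absurd rfl (h13'.ne_of_mem hm h)
        · exact absurd rfl (h13'.ne_of_mem hm h.1)
        · exact h.1
      exact absurd (hP.eq_of_mem hmP hfP hum hu) (h12'.ne_of_mem hm (hFsub hfF))
  · rw [Set.not_nonempty_iff_eq_empty] at hFC'
    have hFC'' : ∀ e ∈ F, e ∉ C' := fun e he h => (hFC' ▸ ⟨he, h⟩ : e ∈ (∅ : Set E))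
    set N := exchange P M3 C'
    have hN : G.IsPM N := isPM_exchange hP hM3 hK'
    have hαN : α ∈ N := Or.inr ⟨hα, hαC'⟩
    have hNM2 : ∀ e ∈ N, e ∈ M2 → e ∈ P ∧ e ∉ C' := by
      rintro e (h | h) he
      · exact h
      · exact absurd rfl (h23'.ne_of_mem he h.1)
    have hlt : (N ∩ M2).ncard < (P ∩ M2).ncard := by
      refine Set.ncard_lt_ncard ⟨fun e he => ⟨(hNM2 e he.1 he.2).1, he.2⟩, fun hsub => ?_⟩
      have hC'13 : C' ⊆ M1 ∪ M3 := by
        intro e he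
        rcases hC'sub he with heP | he3
        · rcases mem_of_isCubic hcubic hM1 hM2 hM3 h12' h13' h23' e with h | h | h
          · exact Or.inl h
          · exact absurd he (hNM2 e (hsub ⟨heP, h⟩).1 h).2
          · exact Or.inr h
        · exact Or.inr he3
      obtain ⟨f, hfF, hfP⟩ := hPF
      obtain ⟨u, hu⟩ : ∃ u, u ∈ G.inc f := ⟨_, Sym2.out_fst_mem _⟩
      have heq : C' = M1 ∪ M3 := hC'.eq_of_mem_of_mem hM1 hM3 hH13.1 hC'13 subset_rfl hαC'
        (Or.inr hα)
      have hsupp : u ∈ G.supp C' := by rw [heq, hH13.2]; exact Set.mem_univ u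
      exact hFC'' f hfF (hK'.2 u hsupp f (Or.inl hfP) hu)
    have no_smaller : ∀ Q, G.IsPM Q → α ∉ Q → Q ∩ M2 ⊆ N → F ∩ Q = ∅ := by
      intro Q hQ hαQ hQN
      by_contra hcon
      have hle := hmin Q ⟨hQ, hαQ, Set.nonempty_iff_ne_empty.2 hcon⟩
      have hle' : (Q ∩ M2).ncard ≤ (N ∩ M2).ncard :=
        Set.ncard_le_ncard fun e he => ⟨hQN he, he.2⟩
      omega
    obtain ⟨C, hC, hCsub, hαC⟩ := exists_isCircuit_mem hM1 hN hαN hα1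
    have hK := hC.isUnionOfComponents hM1 hN hCsub
    refine ⟨M1, N, hM1, hN, Or.inr ⟨Set.inter_subset_left, Set.subset_union_left⟩, C, hC, hCsub,
      hαC, ?_, ?_, fun _ => ⟨C', hC', hαC', ?_, ?_, isPMOn_diff hM3 hK'⟩⟩
    · by_contra hcon
      obtain ⟨f, hfF, hfP⟩ := hPF
      have hempty := no_smaller (exchange N M1 C) (isPM_exchange hN hM1 hK.symm) (by
          rintro (h | h)
          · exact h.2 hαC
          · exact hα1 h.1) (by
          rintro e ⟨h | h, he⟩
          · exact h.1
          · exact absurd rfl (h12'.ne_of_mem h.1 he))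
      have hf : f ∈ F ∩ exchange N M1 C :=
        ⟨hfF, Or.inl ⟨Or.inl ⟨hfP, hFC'' f hfF⟩, fun h => hcon ⟨f, hfF, h⟩⟩⟩
      rw [hempty] at hf
      exact hf
    · intro C'' hC'' hsub hne
      have hempty := no_smaller (exchange M1 N C'')
        (isPM_exchange hM1 hN (hC''.isUnionOfComponents hM1 hN hsub)) (by
          rintro (h | h)
          · exact hα1 h.1
          · exact hne (hC''.eq_of_mem_of_mem hM1 hN hC hsub hCsub h.2 hαC)) (by
          rintro e ⟨h | h, he⟩
          · exact absurd rfl (h12'.ne_of_mem h.1 he)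
          · exact h.1)
      refine Set.eq_empty_of_forall_notMem fun e he => ?_
      have heN : e ∈ N := (hsub he.2).resolve_left fun h => h12'.ne_of_mem h (hFsub he.1) rfl
      have : e ∈ F ∩ exchange M1 N C'' := ⟨he.1, Or.inr ⟨heN, he.2⟩⟩
      rw [hempty] at this
      exact this
    · refine Set.eq_empty_of_forall_notMem ?_
      rintro e ⟨⟨he2, heC⟩, heC'⟩
      have heN : e ∈ N := (hCsub heC).resolve_left fun h => h12'.ne_of_mem h he2 rfl
      exact (hNM2 e heN he2).2 heC'
    · rintro e ⟨he3, heMN⟩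
      exact ⟨he3, fun h => heMN (Or.inr (Or.inr ⟨he3, h⟩))⟩
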